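/- Let l ≥ 1 and n ≥ l + 2. On (ℂ^{16})^{⊗(n+1)} define: P := (orthogonal projection onto span{ψ_0^{⊗n}, ψ_1^{⊗n}}) ⊗ 1, Q := orthogonal projection onto span{ψ_0^{⊗(n+1)}, ψ_1^{⊗(n+1)}}, and R := 1^{⊗(n−l)} ⊗ (orthogonal projection onto span{ψ_σ^{⊗(l+1)} : σ ∈ {0,1,φ}}). Then ‖R(P − Q)‖ ≤ 8.5/2^l, where ‖·‖ is the operator (spectral) norm. -/

import Mathlib

open MeasureTheory Matrix Finset
open scoped Real ComplexConjugate ComplexOrder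

noncomputable section

/-- The operator (spectral) norm of a complex matrix, i.e. the norm of the induced
linear map between Euclidean spaces. -/
def opNorm {m n : Type*} [Fintype m] [Fintype n] [DecidableEq n] (A : Matrix m n ℂ) : ℝ :=
  ‖LinearMap.toContinuousLinearMap (Matrix.toEuclideanLin A)‖

/-- `ψ₀ = ½(|0000⟩+|0101⟩+|1010⟩+|1111⟩)` in `(ℂ²)^{⊗4}`. -/
def psi0 : (Fin 4 → Fin 2) → ℂ :=
  fun b => if b 0 = b 2 ∧ b 1 = b 3 then (1 / 2 : ℂ) else 0
/-- `ψ₁ = ½(|0000⟩+|0110⟩+|1001⟩+|1111⟩)` in `(ℂ²)^{⊗4}`. -/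
def psi1 : (Fin 4 → Fin 2) → ℂ :=
  fun b => if b 0 = b 3 ∧ b 1 = b 2 then (1 / 2 : ℂ) else 0
/-- `ψ_φ = ψ₀ - ψ₁`. -/
def psiphi : (Fin 4 → Fin 2) → ℂ := psi0 - psi1

/-- The tensor power `ψ^{⊗k}` of a vector in `ℂ¹⁶ = (ℂ²)^{⊗4}`. -/
def tpowVec (k : ℕ) (ψ : (Fin 4 → Fin 2) → ℂ) : (Fin k → (Fin 4 → Fin 2)) → ℂ :=
  fun f => ∏ i, ψ (f i)

/-- A spanning vector of `range P = span{ψ₀^{⊗n},ψ₁^{⊗n}} ⊗ ℂ¹⁶`: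
`ψ^{⊗n} ⊗ e_b` on `(ℂ¹⁶)^{⊗(n+1)}`. -/
def pvecP (n : ℕ) (ψ : (Fin 4 → Fin 2) → ℂ) (b : Fin 4 → Fin 2) :
    (Fin (n + 1) → (Fin 4 → Fin 2)) → ℂ :=
  fun f => (∏ i : Fin n, ψ (f i.castSucc)) * (if f (Fin.last n) = b then (1 : ℂ) else 0)

/-- A spanning vector of `range R = ℂ¹⁶^{⊗(n-l)} ⊗ span{ψ_σ^{⊗(l+1)}}`:
`e_g ⊗ ψ^{⊗(l+1)}` on `(ℂ¹⁶)^{⊗(n+1)}`. -/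
def pvecR (n l : ℕ) (hln : l ≤ n) (ψ : (Fin 4 → Fin 2) → ℂ)
    (g : Fin (n - l) → (Fin 4 → Fin 2)) :
    (Fin (n + 1) → (Fin 4 → Fin 2)) → ℂ :=
  fun f => (if ∀ j : Fin (n - l), f ⟨(j : ℕ), by have := j.isLt; omega⟩ = g j
      then (1 : ℂ) else 0) *
    ∏ j : Fin (l + 1), ψ (f ⟨(n - l) + (j : ℕ), by have := j.isLt; omega⟩)

/-- The Hermitian inner product of two vectors given by their coordinates. -/
def ip {ι : Type*} [Fintype ι] (f g : ι → ℂ) : ℂ :=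
  inner ℂ (WithLp.toLp 2 f) (WithLp.toLp 2 g)

/-- The Euclidean norm of a vector given by its coordinates. -/
def nm {ι : Type*} [Fintype ι] (f : ι → ℂ) : ℝ := ‖WithLp.toLp 2 f‖

section InnerProduct

variable {ι : Type*} [Fintype ι]

lemma ip_eq_sum (f g : ι → ℂ) : ip f g = ∑ i, star (f i) * g i := by
  rw [ip, EuclideanSpace.inner_toLp_toLp]
  exact Finset.sum_congr rfl fun i _ => mul_comm _ _

lemma ip_add_left (f g h : ι → ℂ) : ip (f + g) h = ip f h + ip g h := by
  simp only [ip, WithLp.toLp_add, inner_add_left]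

lemma ip_add_right (f g h : ι → ℂ) : ip f (g + h) = ip f g + ip f h := by
  simp only [ip, WithLp.toLp_add, inner_add_right]

lemma ip_sub_left (f g h : ι → ℂ) : ip (f - g) h = ip f h - ip g h := by
  simp only [ip, WithLp.toLp_sub, inner_sub_left]

lemma ip_sub_right (f g h : ι → ℂ) : ip f (g - h) = ip f g - ip f h := by
  simp only [ip, WithLp.toLp_sub, inner_sub_right]

lemma ip_self (f : ι → ℂ) : ip f f = ((nm f ^ 2 : ℝ) : ℂ) := by
  rw [ip, nm, inner_self_eq_norm_sq_to_K]; push_cast; rfl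

lemma norm_ip_le (f g : ι → ℂ) : ‖ip f g‖ ≤ nm f * nm g := norm_inner_le_norm _ _

lemma nm_nonneg (f : ι → ℂ) : 0 ≤ nm f := norm_nonneg _

lemma nm_eq_one {f : ι → ℂ} (h : ip f f = 1) : nm f = 1 := by
  rw [ip_self] at h
  exact (pow_eq_one_iff_of_nonneg (nm_nonneg f) two_ne_zero).1 (by exact_mod_cast h)

lemma ip_mulVec_left {A : Matrix ι ι ℂ} (hA : Aᴴ = A) (f g : ι → ℂ) :
    ip (A.mulVec f) g = ip f (A.mulVec g) := by
  simp only [ip, EuclideanSpace.inner_toLp_toLp]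
  rw [Matrix.star_mulVec, hA, dotProduct_comm, ← Matrix.dotProduct_mulVec, dotProduct_comm]

/-- Orthogonal projections do not increase the norm. -/
lemma nm_mulVec_le {A : Matrix ι ι ℂ} (hA : Aᴴ = A) (hA2 : A * A = A) (f : ι → ℂ) :
    nm (A.mulVec f) ≤ nm f := by
  have h : ip (A.mulVec f) (A.mulVec f) = ip f (A.mulVec f) := by
    rw [ip_mulVec_left hA, Matrix.mulVec_mulVec, hA2]
  have h' := norm_ip_le f (A.mulVec f)
  rw [← h, ip_self, Complex.norm_real, Real.norm_of_nonneg (sq_nonneg _)] at h'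
  nlinarith [nm_nonneg f, nm_nonneg (A.mulVec f)]

lemma opNorm_le_of_nm [DecidableEq ι] {A : Matrix ι ι ℂ} {C : ℝ} (hC : 0 ≤ C)
    (h : ∀ v, nm (A.mulVec v) ≤ C * nm v) : opNorm A ≤ C :=
  ContinuousLinearMap.opNorm_le_bound _ hC fun x => h x.ofLp

end InnerProduct

section Tensor

/-- The local basis labels of `(ℂ²)^{⊗4}`. -/
abbrev Site := Fin 4 → Fin 2

/-- The vector `ψ^{⊗n} ⊗ a`. -/
def tens (n : ℕ) (ψ a : Site → ℂ) : (Fin (n + 1) → Site) → ℂ :=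
  fun f => (∏ i : Fin n, ψ (f i.castSucc)) * a (f (Fin.last n))

/-- The tensor product `p ⊗ q` of vectors on the first `k` and the last `m` sites. -/
def outer {k m N : ℕ} (h : k + m = N) (p : (Fin k → Site) → ℂ) (q : (Fin m → Site) → ℂ) :
    (Fin N → Site) → ℂ :=
  fun f => p (fun j => f ⟨j, by have := j.isLt; omega⟩) *
    q (fun j => f ⟨k + j, by have := j.isLt; omega⟩)

lemma ip_outer {k m N : ℕ} (h : k + m = N) (p p' : (Fin k → Site) → ℂ)
    (q q' : (Fin m → Site) → ℂ) :
    ip (outer h p q) (outer h p' q') = ip p p' * ip q q' := by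
  subst h
  simp only [ip_eq_sum]
  rw [← (Fin.appendEquiv k m).sum_comp, Fintype.sum_prod_type, Finset.sum_mul_sum]
  refine Finset.sum_congr rfl fun c _ => Finset.sum_congr rfl fun d _ => ?_
  have h1 : (fun j : Fin k => Fin.append c d ⟨j, by have := j.isLt; omega⟩) = c :=
    funext fun j => Fin.append_left c d j
  have h2 : (fun j : Fin m => Fin.append c d ⟨k + j, by have := j.isLt; omega⟩) = d :=
    funext fun j => Fin.append_right c d j
  simp only [outer, Fin.appendEquiv, Equiv.coe_fn_mk, h1, h2, star_mul']
  ring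

lemma ip_tpowVec (k : ℕ) (ψ χ : Site → ℂ) : ip (tpowVec k ψ) (tpowVec k χ) = ip ψ χ ^ k := by
  simp only [ip_eq_sum, tpowVec]
  rw [Fintype.sum_pow]
  simp only [star_prod, Finset.prod_mul_distrib]

lemma ip_tens (n : ℕ) (ψ χ a b : Site → ℂ) :
    ip (tens n ψ a) (tens n χ b) = ip ψ χ ^ n * ip a b := by
  rw [← ip_tpowVec]
  simp only [ip_eq_sum]
  rw [← (Fin.snocEquiv fun _ => Site).sum_comp, Fintype.sum_prod_type_right, Finset.sum_mul_sum]
  refine Finset.sum_congr rfl fun c _ => Finset.sum_congr rfl fun d _ => ?_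
  simp only [tens, tpowVec, Fin.snocEquiv, Equiv.coe_fn_mk, Fin.snoc_castSucc, Fin.snoc_last,
    star_mul']
  ring

lemma tpowVec_succ (n : ℕ) (ψ : Site → ℂ) : tpowVec (n + 1) ψ = tens n ψ ψ :=
  funext fun _ => Fin.prod_univ_castSucc _

lemma tens_eq_outer {k l n : ℕ} (h : k + (l + 1) = n + 1) (ψ a : Site → ℂ) :
    tens n ψ a = outer h (tpowVec k ψ) (tens l ψ a) := by
  obtain rfl : n = k + l := by omega
  funext f
  simp only [tens, outer, tpowVec, Fin.prod_univ_add, mul_assoc]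
  rfl

lemma pvecP_eq_tens (n : ℕ) (ψ : Site → ℂ) (b : Site) :
    pvecP n ψ b = tens n ψ (Pi.single b 1) := by
  funext f
  simp only [pvecP, tens, Pi.single_apply]

lemma pvecR_eq_outer {n l : ℕ} (hln : l ≤ n) (ψ : Site → ℂ) (g : Fin (n - l) → Site) :
    pvecR n l hln ψ g =
      outer (show n - l + (l + 1) = n + 1 by omega) (Pi.single g 1) (tens l ψ ψ) := by
  funext f
  rw [← tpowVec_succ]
  simp only [pvecR, outer, tpowVec, Pi.single_apply, funext_iff]

lemma tens_add (n : ℕ) (ψ a b : Site → ℂ) : tens n ψ (a + b) = tens n ψ a + tens n ψ b := by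
  funext f; simp [tens, mul_add]

lemma tens_smul (n : ℕ) (ψ a : Site → ℂ) (c : ℂ) : tens n ψ (c • a) = c • tens n ψ a := by
  funext f; simp [tens, mul_left_comm]

lemma tens_zero (n : ℕ) (ψ : Site → ℂ) : tens n ψ 0 = 0 := by
  funext f; simp [tens]

lemma outer_add {k m N : ℕ} (h : k + m = N) (p p' : (Fin k → Site) → ℂ)
    (q : (Fin m → Site) → ℂ) : outer h (p + p') q = outer h p q + outer h p' q := by
  funext f; simp [outer, add_mul]

lemma outer_smul {k m N : ℕ} (h : k + m = N) (p : (Fin k → Site) → ℂ)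
    (q : (Fin m → Site) → ℂ) (c : ℂ) : outer h (c • p) q = c • outer h p q := by
  funext f; simp [outer, mul_assoc]

lemma outer_zero {k m N : ℕ} (h : k + m = N) (q : (Fin m → Site) → ℂ) :
    outer h 0 q = 0 := by
  funext f; simp [outer]

lemma tens_mem_of_single {n : ℕ} {ψ : Site → ℂ} {S : Submodule ℂ ((Fin (n + 1) → Site) → ℂ)}
    (h : ∀ b, pvecP n ψ b ∈ S) (a : Site → ℂ) : tens n ψ a ∈ S := by
  have : tens n ψ a = ∑ b, a b • pvecP n ψ b := by
    funext f
    simp [tens, pvecP, Finset.sum_apply, mul_comm]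
  rw [this]
  exact S.sum_mem fun b _ => S.smul_mem _ (h b)

lemma exists_tens_of_mem_span {n : ℕ} {w : (Fin (n + 1) → Site) → ℂ}
    (hw : w ∈ Submodule.span ℂ {w | ∃ b, w = pvecP n psi0 b ∨ w = pvecP n psi1 b}) :
    ∃ a b, w = tens n psi0 a + tens n psi1 b := by
  induction hw using Submodule.span_induction with
  | mem x hx =>
    obtain ⟨b, rfl | rfl⟩ := hx
    · exact ⟨Pi.single b 1, 0, by rw [pvecP_eq_tens, tens_zero, add_zero]⟩
    · exact ⟨0, Pi.single b 1, by rw [pvecP_eq_tens, tens_zero, zero_add]⟩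
  | zero => exact ⟨0, 0, by simp [tens_zero]⟩
  | add x y _ _ hx hy =>
    obtain ⟨a, b, rfl⟩ := hx
    obtain ⟨c, d, rfl⟩ := hy
    exact ⟨a + c, b + d, by rw [tens_add, tens_add]; abel⟩
  | smul c x _ hx =>
    obtain ⟨a, b, rfl⟩ := hx
    exact ⟨c • a, c • b, by rw [tens_smul, tens_smul, smul_add]⟩

lemma exists_outer_of_mem_span {n l : ℕ} (hln : l ≤ n) {r : (Fin (n + 1) → Site) → ℂ}
    (hr : r ∈ Submodule.span ℂ {w | ∃ g, w = pvecR n l hln psi0 g ∨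
        w = pvecR n l hln psi1 g ∨ w = pvecR n l hln psiphi g}) :
    ∃ c₀ c₁ c₂, r =
      outer (show n - l + (l + 1) = n + 1 by omega) c₀ (tens l psi0 psi0) +
      outer (show n - l + (l + 1) = n + 1 by omega) c₁ (tens l psi1 psi1) +
      outer (show n - l + (l + 1) = n + 1 by omega) c₂ (tens l psiphi psiphi) := by
  induction hr using Submodule.span_induction with
  | mem x hx =>
    obtain ⟨g, rfl | rfl | rfl⟩ := hx
    · exact ⟨Pi.single g 1, 0, 0, by simp [pvecR_eq_outer, outer_zero]⟩
    · exact ⟨0, Pi.single g 1, 0, by simp [pvecR_eq_outer, outer_zero]⟩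
    · exact ⟨0, 0, Pi.single g 1, by simp [pvecR_eq_outer, outer_zero]⟩
  | zero => exact ⟨0, 0, 0, by simp [outer_zero]⟩
  | add x y _ _ hx hy =>
    obtain ⟨a, b, c, rfl⟩ := hx
    obtain ⟨a', b', c', rfl⟩ := hy
    exact ⟨a + a', b + b', c + c', by simp only [outer_add]; abel⟩
  | smul c x _ hx =>
    obtain ⟨a₀, a₁, a₂, rfl⟩ := hx
    exact ⟨c • a₀, c • a₁, c • a₂, by simp only [outer_smul, smul_add]⟩

end Tensor

section Psi

lemma ip_psi0_psi0 : ip psi0 psi0 = 1 := by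
  simp only [ip_eq_sum, psi0, mul_ite, apply_ite star, ite_mul, ← ite_and, star_zero, zero_mul,
    mul_zero]
  rw [← Finset.sum_filter, Finset.sum_const, show Finset.card _ = 4 from by decide]
  norm_num

lemma ip_psi1_psi1 : ip psi1 psi1 = 1 := by
  simp only [ip_eq_sum, psi1, mul_ite, apply_ite star, ite_mul, ← ite_and, star_zero, zero_mul,
    mul_zero]
  rw [← Finset.sum_filter, Finset.sum_const, show Finset.card _ = 4 from by decide]
  norm_num

lemma ip_psi0_psi1 : ip psi0 psi1 = 1 / 2 := by
  simp only [ip_eq_sum, psi0, psi1, mul_ite, apply_ite star, ite_mul, ← ite_and, star_zero,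
    zero_mul, mul_zero]
  rw [← Finset.sum_filter, Finset.sum_const, show Finset.card _ = 2 from by decide]
  norm_num

lemma ip_psi1_psi0 : ip psi1 psi0 = 1 / 2 := by
  simp only [ip_eq_sum, psi0, psi1, mul_ite, apply_ite star, ite_mul, ← ite_and, star_zero,
    zero_mul, mul_zero]
  rw [← Finset.sum_filter, Finset.sum_const, show Finset.card _ = 2 from by decide]
  norm_num

lemma ip_psiphi_psi0 : ip psiphi psi0 = 1 / 2 := by
  rw [psiphi, ip_sub_left, ip_psi0_psi0, ip_psi1_psi0]; norm_num

lemma ip_psiphi_psi1 : ip psiphi psi1 = -(1 / 2) := by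
  rw [psiphi, ip_sub_left, ip_psi0_psi1, ip_psi1_psi1]; norm_num

lemma ip_psi0_psiphi : ip psi0 psiphi = 1 / 2 := by
  rw [psiphi, ip_sub_right, ip_psi0_psi0, ip_psi0_psi1]; norm_num

lemma ip_psi1_psiphi : ip psi1 psiphi = -(1 / 2) := by
  rw [psiphi, ip_sub_right, ip_psi1_psi0, ip_psi1_psi1]; norm_num

lemma ip_psiphi_psiphi : ip psiphi psiphi = 1 := by
  nth_rw 2 [psiphi]
  rw [ip_sub_right, ip_psiphi_psi0, ip_psiphi_psi1]; norm_num

end Psi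

lemma norm_half_pow (k : ℕ) : ‖(1 / 2 : ℂ) ^ k‖ = (1 / 2 : ℝ) ^ k := by
  simp

lemma norm_neg_half_pow (k : ℕ) : ‖(-(1 / 2) : ℂ) ^ k‖ = (1 / 2 : ℝ) ^ k := by
  simp

/-- `ψ₀^{⊗n} ⊗ a` and `ψ₁^{⊗n} ⊗ b` are almost orthogonal. -/
lemma nm_sq_tens_add_ge (n : ℕ) (a b : Site → ℂ) :
    (1 - (1 / 2) ^ n) * (nm a ^ 2 + nm b ^ 2) ≤ nm (tens n psi0 a + tens n psi1 b) ^ 2 := by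
  have h := ip_self (tens n psi0 a + tens n psi1 b)
  simp only [ip_add_left, ip_add_right, ip_tens, ip_psi0_psi0, ip_psi0_psi1, ip_psi1_psi0,
    ip_psi1_psi1, one_pow, one_mul, ip_self a, ip_self b] at h
  have h1 := congrArg Complex.re h
  simp only [Complex.add_re, Complex.ofReal_re] at h1
  have e1 := (Complex.abs_re_le_norm ((1 / 2) ^ n * ip a b))
  have e2 := (Complex.abs_re_le_norm ((1 / 2) ^ n * ip b a))
  rw [norm_mul, norm_half_pow] at e1 e2
  have hp : (0 : ℝ) ≤ (1 / 2) ^ n := by positivity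
  have f1 := mul_le_mul_of_nonneg_left (norm_ip_le a b) hp
  have f2 := mul_le_mul_of_nonneg_left (norm_ip_le b a) hp
  have g := mul_nonneg hp (sq_nonneg (nm a - nm b))
  have := neg_abs_le (((1 / 2) ^ n * ip a b : ℂ).re)
  have := neg_abs_le (((1 / 2) ^ n * ip b a : ℂ).re)
  nlinarith

/-- The three blocks `ℂ^{16^k} ⊗ ψ_σ^{⊗(l+1)}` are almost orthogonal. -/
lemma nm_sq_outer_add_ge {k l N : ℕ} (h : k + (l + 1) = N) (c₀ c₁ c₂ : (Fin k → Site) → ℂ) :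
    (1 - (1 / 2) ^ l) * (nm c₀ ^ 2 + nm c₁ ^ 2 + nm c₂ ^ 2) ≤
      nm (outer h c₀ (tens l psi0 psi0) + outer h c₁ (tens l psi1 psi1) +
        outer h c₂ (tens l psiphi psiphi)) ^ 2 := by
  have h0 := ip_self (outer h c₀ (tens l psi0 psi0) + outer h c₁ (tens l psi1 psi1) +
        outer h c₂ (tens l psiphi psiphi))
  simp only [ip_add_left, ip_add_right, ip_outer, ip_tens, ip_psi0_psi0, ip_psi0_psi1,
    ip_psi1_psi0, ip_psi1_psi1, ip_psiphi_psi0, ip_psiphi_psi1, ip_psi0_psiphi, ip_psi1_psiphi,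
    ip_psiphi_psiphi, one_pow, mul_one, ip_self c₀, ip_self c₁, ip_self c₂, ← pow_succ] at h0
  have h1 := congrArg Complex.re h0
  simp only [Complex.add_re, Complex.ofReal_re] at h1
  have hp : (0 : ℝ) ≤ (1 / 2) ^ (l + 1) := by positivity
  have key (c d : (Fin k → Site) → ℂ) (z : ℂ) (hz : ‖z‖ = (1 / 2) ^ (l + 1)) :
      -((1 / 2) ^ (l + 1) * ((nm c ^ 2 + nm d ^ 2) / 2)) ≤ (ip c d * z).re := by
    have e := Complex.abs_re_le_norm (ip c d * z)
    rw [norm_mul, hz] at e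
    have f := mul_le_mul_of_nonneg_right (norm_ip_le c d) hp
    have g := mul_nonneg hp (sq_nonneg (nm c - nm d))
    have := neg_abs_le (ip c d * z).re
    nlinarith
  have k01 := key c₀ c₁ _ (norm_half_pow _)
  have k10 := key c₁ c₀ _ (norm_half_pow _)
  have k02 := key c₀ c₂ _ (norm_half_pow _)
  have k20 := key c₂ c₀ _ (norm_half_pow _)
  have k12 := key c₁ c₂ _ (norm_neg_half_pow _)
  have k21 := key c₂ c₁ _ (norm_neg_half_pow _)
  have hl : ((1 : ℝ) / 2) ^ l = 2 * (1 / 2) ^ (l + 1) := by rw [pow_succ]; ring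
  rw [hl]
  linarith

lemma le_of_frame_bounds {x y z A B N W ε : ℝ} (hN : 0 ≤ N) (hW : 0 ≤ W) (hε : 0 ≤ ε)
    (h1 : x ^ 2 + y ^ 2 + z ^ 2 ≤ 2 * N ^ 2) (h2 : A ^ 2 + B ^ 2 ≤ 8 / 7 * W ^ 2)
    (h3 : N ^ 2 ≤ ε * (5 / 4 * (x * B) + 5 / 4 * (y * A) + z * (A + B))) :
    N ≤ 8.5 * ε * W := by
  set s := 5 / 4 * (x * B) + 5 / 4 * (y * A) + z * (A + B) with hs
  have hcs : s ^ 2 ≤ (x ^ 2 + y ^ 2 + z ^ 2) * (57 / 16 * (A ^ 2 + B ^ 2)) := by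
    have : s ^ 2 ≤ (x ^ 2 + y ^ 2 + z ^ 2) * ((5 / 4 * B) ^ 2 + (5 / 4 * A) ^ 2 + (A + B) ^ 2) := by
      rw [hs]
      nlinarith [sq_nonneg (x * (5 / 4 * A) - y * (5 / 4 * B)),
        sq_nonneg (x * (A + B) - z * (5 / 4 * B)), sq_nonneg (y * (A + B) - z * (5 / 4 * A))]
    refine this.trans (mul_le_mul_of_nonneg_left ?_ (by positivity))
    nlinarith [sq_nonneg (A - B)]
  have hcs' : s ^ 2 ≤ (2 * N ^ 2) * (57 / 16 * (8 / 7 * W ^ 2)) :=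
    hcs.trans (mul_le_mul h1 (by linarith) (by positivity) (by positivity))
  have hb : s ≤ 8.5 * N * W := by
    refine le_of_abs_le (abs_le_of_sq_le_sq ?_ (by positivity))
    nlinarith [mul_nonneg (sq_nonneg N) (sq_nonneg W)]
  have h4 : N * N ≤ N * (8.5 * ε * W) := by
    nlinarith [mul_le_mul_of_nonneg_left hb hε]
  rcases hN.eq_or_lt with h | h
  · rw [← h]; positivity
  · exact le_of_mul_le_mul_left h4 h

/-- A vector of `range P ⊖ range Q` is almost orthogonal to `range R`: the norm of the component
along `range R` is bounded. -/
lemma nm_le_of_ip_self_eq {n l : ℕ} (hl : 1 ≤ l) (hn : l + 2 ≤ n) {a b : Site → ℂ}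
    {w : (Fin (n + 1) → Site) → ℂ} (hw : w = tens n psi0 a + tens n psi1 b)
    (hw0 : ip (tens n psi0 psi0) w = 0) (hw1 : ip (tens n psi1 psi1) w = 0)
    {c₀ c₁ c₂ : (Fin (n - l) → Site) → ℂ} {r : (Fin (n + 1) → Site) → ℂ}
    (h : n - l + (l + 1) = n + 1)
    (hr : r = outer h c₀ (tens l psi0 psi0) + outer h c₁ (tens l psi1 psi1) +
      outer h c₂ (tens l psiphi psiphi)) (hrw : ip r r = ip r w) :
    nm r ≤ 8.5 * (1 / 2) ^ l * nm w := by
  set ε : ℝ := (1 / 2) ^ l with hε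
  have hε0 : 0 ≤ ε := by positivity
  have hε1 : ε ≤ 1 / 2 := by
    simpa only [pow_one] using
      pow_le_pow_of_le_one (by norm_num : (0 : ℝ) ≤ 1 / 2) (by norm_num) hl
  have hδ : (1 / 2 : ℝ) ^ n ≤ ε / 4 := by
    have := pow_le_pow_of_le_one (by norm_num : (0 : ℝ) ≤ 1 / 2) (by norm_num) hn
    rw [pow_add] at this
    linarith
  have hA := nm_nonneg a
  have hB := nm_nonneg b
  have n0 : nm psi0 = 1 := nm_eq_one ip_psi0_psi0
  have n1 : nm psi1 = 1 := nm_eq_one ip_psi1_psi1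
  have nφ : nm psiphi = 1 := nm_eq_one ip_psiphi_psiphi
  have np0 : nm (tpowVec (n - l) psi0) = 1 :=
    nm_eq_one (by rw [ip_tpowVec, ip_psi0_psi0, one_pow])
  have np1 : nm (tpowVec (n - l) psi1) = 1 :=
    nm_eq_one (by rw [ip_tpowVec, ip_psi1_psi1, one_pow])
  have i0b : ‖ip psi0 b‖ ≤ nm b := by simpa [n0] using norm_ip_le psi0 b
  have i1a : ‖ip psi1 a‖ ≤ nm a := by simpa [n1] using norm_ip_le psi1 a
  have iφa : ‖ip psiphi a‖ ≤ nm a := by simpa [nφ] using norm_ip_le psiphi a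
  have iφb : ‖ip psiphi b‖ ≤ nm b := by simpa [nφ] using norm_ip_le psiphi b
  have i0a : ‖ip psi0 a‖ ≤ ε / 4 * nm b := by
    rw [hw, ip_add_right, ip_tens, ip_tens, ip_psi0_psi0, ip_psi0_psi1, one_pow, one_mul] at hw0
    rw [eq_neg_of_add_eq_zero_left hw0, norm_neg, norm_mul, norm_half_pow]
    gcongr
  have i1b : ‖ip psi1 b‖ ≤ ε / 4 * nm a := by
    rw [hw, ip_add_right, ip_tens, ip_tens, ip_psi1_psi0, ip_psi1_psi1, one_pow, one_mul] at hw1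
    rw [eq_neg_of_add_eq_zero_right hw1, norm_neg, norm_mul, norm_half_pow]
    gcongr
  have hlow := nm_sq_outer_add_ge h c₀ c₁ c₂
  rw [← hr] at hlow
  have hlow' := nm_sq_tens_add_ge n a b
  rw [← hw] at hlow'
  have j (c p : (Fin (n - l) → Site) → ℂ) (hp : nm p = 1) (z : ℂ) {t : ℝ} (hz : ‖z‖ ≤ t) :
      ‖ip c p * z‖ ≤ nm c * t := by
    rw [norm_mul]
    have := norm_ip_le c p
    rw [hp, mul_one] at this
    exact mul_le_mul this hz (norm_nonneg _) (nm_nonneg _)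
  have half {z : ℂ} {t : ℝ} (hz : ‖z‖ ≤ t) : ‖(1 / 2 : ℂ) ^ l * z‖ ≤ ε * t := by
    rw [norm_mul, norm_half_pow]; gcongr
  have nhalf {z : ℂ} {t : ℝ} (hz : ‖z‖ ≤ t) : ‖(-(1 / 2) : ℂ) ^ l * z‖ ≤ ε * t := by
    rw [norm_mul, norm_neg_half_pow]; gcongr
  have hup : nm r ^ 2 ≤
      ε * (5 / 4 * (nm c₀ * nm b) + 5 / 4 * (nm c₁ * nm a) + nm c₂ * (nm a + nm b)) := by
    have hn : nm r ^ 2 = ‖ip r w‖ := by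
      rw [← hrw, ip_self, Complex.norm_real, Real.norm_of_nonneg (sq_nonneg _)]
    rw [hn, hr, hw, tens_eq_outer h, tens_eq_outer h]
    simp only [ip_add_left, ip_add_right, ip_outer, ip_tens, ip_psi0_psi0, ip_psi0_psi1,
      ip_psi1_psi0, ip_psi1_psi1, ip_psiphi_psi0, ip_psiphi_psi1, one_pow, one_mul]
    have b00 := j c₀ _ np0 _ i0a
    have b01 := j c₀ _ np1 _ (half i0b)
    have b10 := j c₁ _ np0 _ (half i1a)
    have b11 := j c₁ _ np1 _ i1b
    have b20 := j c₂ _ np0 _ (half iφa)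
    have b21 := j c₂ _ np1 _ (nhalf iφb)
    refine (norm_add_le _ _).trans ((add_le_add (norm_add_le _ _) (norm_add_le _ _)).trans
      ((add_le_add (add_le_add ((norm_add_le _ _).trans (add_le_add b00 b10)) b20)
        (add_le_add ((norm_add_le _ _).trans (add_le_add b01 b11)) b21)).trans ?_))
    linarith
  refine le_of_frame_bounds (nm_nonneg _) (nm_nonneg _) hε0 ?_ ?_ hup
  · nlinarith [sq_nonneg (nm c₀), sq_nonneg (nm c₁), sq_nonneg (nm c₂)]
  · nlinarith [sq_nonneg (nm a), sq_nonneg (nm b)]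

/-- **Verification of the third Nachtergaele condition:** with
`P = (proj onto span{ψ₀^{⊗n},ψ₁^{⊗n}}) ⊗ 1`, `Q = proj onto
span{ψ₀^{⊗(n+1)},ψ₁^{⊗(n+1)}}` and `R = 1^{⊗(n-l)} ⊗ (proj onto
span{ψ_σ^{⊗(l+1)} : σ ∈ {0,1,φ}})`, one has `‖R(P - Q)‖ ≤ 8.5/2^l`. -/
theorem nachtergaele_condition_three (n l : ℕ) (hl : 1 ≤ l) (hn : l + 2 ≤ n)
    (P Q R : Matrix (Fin (n + 1) → (Fin 4 → Fin 2)) (Fin (n + 1) → (Fin 4 → Fin 2)) ℂ)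
    (hPidem : P * P = P) (hPherm : Pᴴ = P)
    (hPrange : ∀ v, P.mulVec v = v ↔
      v ∈ Submodule.span ℂ {w | ∃ b, w = pvecP n psi0 b ∨ w = pvecP n psi1 b})
    (hQidem : Q * Q = Q) (hQherm : Qᴴ = Q)
    (hQrange : ∀ v, Q.mulVec v = v ↔
      v ∈ Submodule.span ℂ {tpowVec (n + 1) psi0, tpowVec (n + 1) psi1})
    (hRidem : R * R = R) (hRherm : Rᴴ = R)
    (hRrange : ∀ v, R.mulVec v = v ↔
      v ∈ Submodule.span ℂ {w | ∃ g, w = pvecR n l (by omega) psi0 g ∨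
        w = pvecR n l (by omega) psi1 g ∨ w = pvecR n l (by omega) psiphi g}) :
    opNorm (R * (P - Q)) ≤ 8.5 / 2 ^ l := by
  have hPQ : P * Q = Q := by
    refine Matrix.ext_of_mulVec_single fun i => ?_
    rw [← Matrix.mulVec_mulVec, hPrange]
    have h := (hQrange (Q.mulVec (Pi.single i 1))).1 (by rw [Matrix.mulVec_mulVec, hQidem])
    refine Submodule.span_le.2 ?_ h
    rintro _ (rfl | rfl) <;> rw [tpowVec_succ, SetLike.mem_coe]
    · refine tens_mem_of_single (fun b => ?_) _
      exact Submodule.subset_span ⟨b, Or.inl rfl⟩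
    · refine tens_mem_of_single (fun b => ?_) _
      exact Submodule.subset_span ⟨b, Or.inr rfl⟩
  have hQP : Q * P = Q := by
    simpa [hPherm, hQherm] using congrArg Matrix.conjTranspose hPQ
  have hDherm : (P - Q)ᴴ = P - Q := by rw [Matrix.conjTranspose_sub, hPherm, hQherm]
  have hDidem : (P - Q) * (P - Q) = P - Q := by
    rw [sub_mul, mul_sub, mul_sub, hPidem, hPQ, hQP, hQidem, sub_self, sub_zero]
  refine opNorm_le_of_nm (by positivity) fun v => ?_
  set w := (P - Q).mulVec v with hw
  have hPw : P.mulVec w = w := by rw [hw, Matrix.mulVec_mulVec, mul_sub, hPidem, hPQ]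
  have hQw : Q.mulVec w = 0 := by
    rw [hw, Matrix.mulVec_mulVec, mul_sub, hQP, hQidem, sub_self, Matrix.zero_mulVec]
  have hperp (t : (Fin (n + 1) → Site) → ℂ)
      (ht : t ∈ Submodule.span ℂ {tpowVec (n + 1) psi0, tpowVec (n + 1) psi1}) : ip t w = 0 := by
    rw [← (hQrange t).2 ht, ip_mulVec_left hQherm, hQw]
    simp [ip]
  obtain ⟨a, b, hab⟩ := exists_tens_of_mem_span ((hPrange w).1 hPw)
  obtain ⟨c₀, c₁, c₂, hc⟩ := exists_outer_of_mem_span (by omega)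
    ((hRrange (R.mulVec w)).1 (by rw [Matrix.mulVec_mulVec, hRidem]))
  have hmain := nm_le_of_ip_self_eq hl hn hab
    (hperp _ (Submodule.subset_span (Or.inl (tpowVec_succ n psi0).symm)))
    (hperp _ (Submodule.subset_span (Or.inr (tpowVec_succ n psi1).symm))) _ hc
    (by rw [ip_mulVec_left hRherm, Matrix.mulVec_mulVec, hRidem, ip_mulVec_left hRherm])
  rw [← Matrix.mulVec_mulVec, ← hw]
  calc nm (R.mulVec w) ≤ 8.5 * (1 / 2) ^ l * nm w := hmain
    _ ≤ 8.5 * (1 / 2) ^ l * nm v := by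
      gcongr
      exact nm_mulVec_le hDherm hDidem v
    _ = 8.5 / 2 ^ l * nm v := by rw [one_div, inv_pow, div_eq_mul_inv]
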